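/- arXiv:1712.01637 — 16 statements merged into one kernel-verified Lean document; each statement's English description precedes it below -/
import Mathlib

section
/- Let q : A ⟶ B and m : B ⟶ C be morphisms in an abelian category with q an epimorphism. Since (kernel.ι q) ≫ q ≫ m = 0, there is a canonical morphism kernel q ⟶ kernel (q ≫ m) (namely kernel.lift (q ≫ m) (kernel.ι q) _). If this canonical morphism is an isomorphism (i.e. m ∘ q and q have the same kernel), then m is a monomorphism. -/
open CategoryTheory CategoryTheory.Limits

/-- Proposition 2 of §1 (dual converse part): if `q` is an epimorphism and the canonical
morphism `kernel q ⟶ kernel (q ≫ m)` is an isomorphism (i.e. `q ≫ m` and `q` have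
the same kernel), then `m` is a monomorphism. -/
theorem stmt1 {𝒜 : Type*} [Category 𝒜] [Abelian 𝒜] {A B C : 𝒜}
    (q : A ⟶ B) (m : B ⟶ C) [Epi q]
    (h : IsIso (kernel.lift (q ≫ m) (kernel.ι q)
      (by rw [← Category.assoc, kernel.condition, Limits.zero_comp]))) :
    Mono m := by
  refine Preadditive.mono_of_cancel_zero m fun {T} g hg => ?_
  have hker : kernel.ι (q ≫ m) ≫ q = 0 := by
    rw [← cancel_epi (kernel.lift (q ≫ m) (kernel.ι q) _), kernel.lift_ι_assoc,
      comp_zero]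
    exact kernel.condition q
  have hfst : pullback.fst q g ≫ q ≫ m = 0 := by
    rw [pullback.condition_assoc, hg, comp_zero]
  rw [← cancel_epi (pullback.snd q g), ← pullback.condition, comp_zero,
    ← kernel.lift_ι (q ≫ m) (pullback.fst q g) hfst, Category.assoc, hker, comp_zero]
end

section
/- Let a commutative square in an abelian category be given by top arrow f : A ⟶ B, left arrow u : A ⟶ A', right arrow v : B ⟶ B', bottom arrow f' : A' ⟶ B' with v ∘ f = f' ∘ u. Let P = pullback v f' with projections fst : P ⟶ B and snd : P ⟶ A', and let e : A ⟶ P be the comparison morphism pullback.lift f u (so fst ∘ e = f and snd ∘ e = u). Then e is an epimorphism if and only if the square is semi-cartesian. -/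
open CategoryTheory CategoryTheory.Limits

variable {𝒜 : Type*} [Category 𝒜] [Abelian 𝒜]

/-- A commutative square with top arrow `f`, left arrow `u`, right arrow `v` and bottom
arrow `f'` is *semi-cartesian* if the sequence `A ⟶ B ⊞ A' ⟶ B'` is exact, where the
first morphism is `biprod.lift f u` and the second is `biprod.desc v (-f')`. -/
def IsSemiCartesian {A B A' B' : 𝒜} (f : A ⟶ B) (u : A ⟶ A') (v : B ⟶ B')
    (f' : A' ⟶ B') : Prop :=
  ∃ (z : biprod.lift f u ≫ biprod.desc v (-f') = 0),
    (ShortComplex.mk (biprod.lift f u) (biprod.desc v (-f')) z).Exact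

/-- Proposition 1 of §2, (i) ⇔ (iv): the comparison morphism `e : A ⟶ pullback v f'`
is an epimorphism iff the square is semi-cartesian. -/
theorem stmt3 {A B A' B' : 𝒜} (f : A ⟶ B) (u : A ⟶ A') (v : B ⟶ B') (f' : A' ⟶ B')
    (sq : f ≫ v = u ≫ f') :
    Epi (pullback.lift f u sq) ↔ IsSemiCartesian f u v f' := by
  have z : biprod.lift f u ≫ biprod.desc v (-f') = 0 := by
    rw [biprod.lift_desc, Preadditive.comp_neg, sq, add_neg_cancel]
  rw [IsSemiCartesian, exists_prop_of_true z, epi_iff_surjective_up_to_refinements,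
    ShortComplex.exact_iff_exact_up_to_refinements]
  constructor
  · intro h T (x : T ⟶ B ⊞ A') (hx : x ≫ biprod.desc v (-f') = 0)
    have hx' : (x ≫ biprod.fst) ≫ v = (x ≫ biprod.snd) ≫ f' := by
      simpa [biprod.desc_eq, add_neg_eq_zero] using hx
    obtain ⟨T', π, hπ, a, ha⟩ := h (pullback.lift _ _ hx')
    refine ⟨T', π, hπ, a, biprod.hom_ext _ _ ?_ ?_⟩
    · simpa [pullback.lift_fst] using ha =≫ pullback.fst v f'
    · simpa [pullback.lift_snd] using ha =≫ pullback.snd v f'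
  · intro h T y
    obtain ⟨T', π, hπ, a, ha⟩ :=
      h (y ≫ biprod.lift (pullback.fst v f') (pullback.snd v f'))
        (by simp [pullback.condition])
    refine ⟨T', π, hπ, a, pullback.hom_ext ?_ ?_⟩
    · simpa [pullback.lift_fst] using ha =≫ biprod.fst
    · simpa [pullback.lift_snd] using ha =≫ biprod.snd
end

section
/- Let a commutative square in an abelian category be given by top arrow f : A ⟶ B, left arrow u : A ⟶ A', right arrow v : B ⟶ B', bottom arrow f' : A' ⟶ B' with v ∘ f = f' ∘ u. Let S = pushout f u with injections inl : B ⟶ S and inr : A' ⟶ S, and let m : S ⟶ B' be the comparison morphism pushout.desc v f' (so m ∘ inl = v and m ∘ inr = f'). Then m is a monomorphism if and only if the square is semi-cartesian. -/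
open CategoryTheory CategoryTheory.Limits

variable {𝒜 : Type*} [Category 𝒜] [Abelian 𝒜]

/-- The pushout of `f` and `u` is the cokernel of `biprod.lift f u`, with the second injection
taken with a minus sign. -/
noncomputable def pushoutIsoCokernelBiprodLift {A B A' : 𝒜} (f : A ⟶ B) (u : A ⟶ A') :
    pushout f u ≅ cokernel (biprod.lift f u) where
  hom := pushout.desc (biprod.inl ≫ cokernel.π _) (-(biprod.inr ≫ cokernel.π _)) (by
    have h : biprod.lift f u ≫ cokernel.π (biprod.lift f u) = 0 := cokernel.condition _
    rw [biprod.lift_eq, Preadditive.add_comp, Category.assoc, Category.assoc, ← biprod.lift_eq] at h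
    rw [Preadditive.comp_neg]
    exact eq_neg_of_add_eq_zero_left h)
  inv := cokernel.desc _ (biprod.desc (pushout.inl f u) (-pushout.inr f u))
    (by simp [biprod.lift_desc, pushout.condition])
  hom_inv_id := by
    apply pushout.hom_ext <;> simp [pushout.inl_desc_assoc, pushout.inr_desc_assoc]
  inv_hom_id := by
    apply coequalizer.hom_ext
    apply biprod.hom_ext' <;> simp [pushout.inl_desc, pushout.inr_desc]

/-- Proposition 1 of §2, (ii) ⇔ (iv): the comparison morphism `m : pushout f u ⟶ B'`
is a monomorphism iff the square is semi-cartesian. -/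
theorem stmt4 {A B A' B' : 𝒜} (f : A ⟶ B) (u : A ⟶ A') (v : B ⟶ B') (f' : A' ⟶ B')
    (sq : f ≫ v = u ≫ f') :
    Mono (pushout.desc v f' sq) ↔ IsSemiCartesian f u v f' := by
  have z : biprod.lift f u ≫ biprod.desc v (-f') = 0 := by simp [biprod.lift_desc, sq]
  have comparison : pushout.desc v f' sq =
      (pushoutIsoCokernelBiprodLift f u).hom ≫ cokernel.desc _ (biprod.desc v (-f')) z := by
    apply pushout.hom_ext <;>
      simp [pushoutIsoCokernelBiprodLift, pushout.inl_desc_assoc, pushout.inr_desc_assoc,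
        pushout.inl_desc, pushout.inr_desc]
  rw [comparison, mono_comp_iff_of_isIso, IsSemiCartesian, exists_prop_of_true z]
  exact (ShortComplex.exact_iff_mono_cokernel_desc
    (ShortComplex.mk (biprod.lift f u) (biprod.desc v (-f')) z)).symm
end

section
/- Let a commutative square in an abelian category be given by top arrow f : A ⟶ B, left arrow u : A ⟶ A', right arrow v : B ⟶ B', bottom arrow f' : A' ⟶ B' with v ∘ f = f' ∘ u. Let P = pullback v f' with projections fst : P ⟶ B, snd : P ⟶ A', and S = pushout f u with injections inl : B ⟶ S, inr : A' ⟶ S. Set n = biprod.lift fst snd : P ⟶ B ⊞ A' and t = biprod.desc inl (−inr) : B ⊞ A' ⟶ S. Then the sequence 0 ⟶ P ⟶ B ⊞ A' ⟶ S ⟶ 0 is exact (i.e. n is a kernel of t and t is a cokernel of n) if and only if the square is semi-cartesian. -/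
open CategoryTheory CategoryTheory.Limits

variable {𝒜 : Type*} [Category 𝒜] [Abelian 𝒜]

/-- The kernel of `biprod.desc v (-f')` is the pullback of `v` and `f'`. -/
noncomputable def pullbackIsKernel {B A' B' : 𝒜} (v : B ⟶ B') (f' : A' ⟶ B')
    (w : biprod.lift (pullback.fst v f') (pullback.snd v f') ≫ biprod.desc v (-f') = 0) :
    IsLimit (KernelFork.ofι (biprod.lift (pullback.fst v f') (pullback.snd v f')) w) :=
  (IsPullback.of_hasPullback v f').isLimitKernelFork

/-- The cokernel of `biprod.lift f u` is the pushout of `f` and `u`, with second injection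
negated. -/
noncomputable def pushoutIsCokernel {A B A' : 𝒜} (f : A ⟶ B) (u : A ⟶ A')
    (w : biprod.lift f u ≫ biprod.desc (pushout.inl f u) (-pushout.inr f u) = 0) :
    IsColimit (CokernelCofork.ofπ (biprod.desc (pushout.inl f u) (-pushout.inr f u)) w) :=
  CokernelCofork.IsColimit.ofπ _ _
    (fun x hx => pushout.desc (biprod.inl ≫ x) (-(biprod.inr ≫ x)) (by
      rw [biprod.lift_eq, Preadditive.add_comp, Category.assoc, Category.assoc] at hx
      rw [Preadditive.comp_neg]
      exact eq_neg_of_add_eq_zero_left hx))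
    (fun x hx => by
      apply biprod.hom_ext'
      · rw [biprod.inl_desc_assoc]
        exact pushout.inl_desc _ _ _
      · rw [biprod.inr_desc_assoc, Preadditive.neg_comp, neg_eq_iff_eq_neg]
        exact pushout.inr_desc _ _ _)
    (fun x hx m hm => by
      apply pushout.hom_ext
      · refine Eq.trans ?_ (pushout.inl_desc _ _ _).symm
        rw [← hm, biprod.inl_desc_assoc]
      · refine Eq.trans ?_ (pushout.inr_desc _ _ _).symm
        rw [← hm, biprod.inr_desc_assoc, Preadditive.neg_comp, neg_neg])

/-- If `n` is a kernel of `b`, `t` is a cokernel of `a`, and `a ≫ b = 0`, then the sequence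
`a, b` is exact if and only if `n, t` is a kernel-cokernel pair. -/
theorem exact_iff_isKernel_and_isCokernel {A P X S B' : 𝒜} {a : A ⟶ X} {b : X ⟶ B'}
    {n : P ⟶ X} {t : X ⟶ S} (hab : a ≫ b = 0) {wn : n ≫ b = 0} {wt : a ≫ t = 0}
    (hn : IsLimit (KernelFork.ofι n wn)) (ht : IsColimit (CokernelCofork.ofπ t wt)) :
    (ShortComplex.mk a b hab).Exact ↔
      ∃ z : n ≫ t = 0, Nonempty (IsLimit (KernelFork.ofι n z)) ∧
        Nonempty (IsColimit (CokernelCofork.ofπ t z)) := by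
  rw [ShortComplex.exact_iff_of_forks (S := ShortComplex.mk a b hab) hn ht]
  change n ≫ t = 0 ↔ _
  refine ⟨fun z => ⟨z, ⟨?_⟩, ⟨?_⟩⟩, fun ⟨z, _⟩ => z⟩
  · obtain ⟨d, hd⟩ := CokernelCofork.IsColimit.desc' ht b hab
    replace hd : t ≫ d = b := hd
    exact isKernelOfComp d b hn z hd
  · obtain ⟨l, hl⟩ := KernelFork.IsLimit.lift' hn a hab
    replace hl : l ≫ n = a := hl
    exact isCokernelOfComp l a ht z hl

/-- Proposition 1 of §2, (iii) ⇔ (iv): with `n = biprod.lift fst snd : pullback v f' ⟶ B ⊞ A'`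
and `t = biprod.desc inl (-inr) : B ⊞ A' ⟶ pushout f u`, the sequence
`0 ⟶ P ⟶ B ⊞ A' ⟶ S ⟶ 0` is exact (`n` is a kernel of `t` and `t` is a cokernel of `n`)
iff the square is semi-cartesian. -/
theorem stmt5 {A B A' B' : 𝒜} (f : A ⟶ B) (u : A ⟶ A') (v : B ⟶ B') (f' : A' ⟶ B')
    (sq : f ≫ v = u ≫ f') :
    (∃ (z : biprod.lift (pullback.fst v f') (pullback.snd v f') ≫
        biprod.desc (pushout.inl f u) (-pushout.inr f u) = 0),
      Nonempty (IsLimit (KernelFork.ofι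
        (biprod.lift (pullback.fst v f') (pullback.snd v f')) z)) ∧
      Nonempty (IsColimit (CokernelCofork.ofπ
        (biprod.desc (pushout.inl f u) (-pushout.inr f u)) z))) ↔
    IsSemiCartesian f u v f' := by
  have hab : biprod.lift f u ≫ biprod.desc v (-f') = 0 := by simp [sq]
  have wn : biprod.lift (pullback.fst v f') (pullback.snd v f') ≫ biprod.desc v (-f') = 0 := by
    simp [pullback.condition]
  have wt : biprod.lift f u ≫ biprod.desc (pushout.inl f u) (-pushout.inr f u) = 0 := by
    simp [pushout.condition]
  rw [← exact_iff_isKernel_and_isCokernel hab (pullbackIsKernel v f' wn) (pushoutIsCokernel f u wt)]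
  exact ⟨fun h => ⟨hab, h⟩, fun ⟨_, h⟩ => h⟩
end

section
/- Let a semi-cartesian square in an abelian category be given by top arrow f : A ⟶ B, left arrow u : A ⟶ A', right arrow v : B ⟶ B', bottom arrow f' : A' ⟶ B' with v ∘ f = f' ∘ u. If the top arrow f is a monomorphism, then the bottom arrow f' is a monomorphism and the square is cartesian (the commutative square is a pullback square, i.e. the cone with legs f and u is a limit of the cospan v, f'). -/
open CategoryTheory CategoryTheory.Limits

variable {𝒜 : Type*} [Category 𝒜] [Abelian 𝒜]

/-- In a semi-cartesian square whose top arrow is a monomorphism, every pair of morphisms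
to `B` and `A'` that agree in `B'` factors through `A`. -/
lemma IsSemiCartesian.exists_lift {A B A' B' : 𝒜} {f : A ⟶ B} {u : A ⟶ A'} {v : B ⟶ B'}
    {f' : A' ⟶ B'} (hsc : IsSemiCartesian f u v f') [Mono f] {T : 𝒜} (b : T ⟶ B) (a' : T ⟶ A')
    (h : b ≫ v = a' ≫ f') : ∃ a : T ⟶ A, a ≫ f = b ∧ a ≫ u = a' := by
  obtain ⟨z, hz⟩ := hsc
  have : Mono (biprod.lift f u) := mono_of_mono_fac (biprod.lift_fst f u)
  obtain ⟨a, ha⟩ := KernelFork.IsLimit.lift' hz.fIsKernel (biprod.lift b a') (by simp [h])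
  have ha : a ≫ biprod.lift f u = biprod.lift b a' := ha
  exact ⟨a, by simpa using ha =≫ biprod.fst, by simpa using ha =≫ biprod.snd⟩

/-- Proposition 2 of §2 (first half): in a semi-cartesian square, if the top arrow `f`
is a monomorphism, then the bottom arrow `f'` is a monomorphism and the square is
cartesian. -/
theorem stmt6 {A B A' B' : 𝒜} (f : A ⟶ B) (u : A ⟶ A') (v : B ⟶ B') (f' : A' ⟶ B')
    (sq : f ≫ v = u ≫ f') (hsc : IsSemiCartesian f u v f') [Mono f] :
    Mono f' ∧ IsPullback f u v f' := by
  refine ⟨Preadditive.mono_of_cancel_zero f' fun {T} x hx ↦ ?_, ⟨⟨sq⟩, ⟨?_⟩⟩⟩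
  · obtain ⟨a, haf, hau⟩ := hsc.exists_lift (0 : T ⟶ B) x (by simp [hx])
    rw [← hau, zero_of_comp_mono f haf, zero_comp]
  · choose l hlf hlu using fun s : PullbackCone v f' ↦
      hsc.exists_lift s.fst s.snd s.condition
    exact PullbackCone.IsLimit.mk sq l hlf hlu fun s m hm _ ↦
      (cancel_mono f).1 (hm.trans (hlf s).symm)
end

section
/- Let a semi-cartesian square in an abelian category be given by top arrow f : A ⟶ B, left arrow u : A ⟶ A', right arrow v : B ⟶ B', bottom arrow f' : A' ⟶ B' with v ∘ f = f' ∘ u. If the bottom arrow f' is an epimorphism, then the top arrow f is an epimorphism and the square is cocartesian (the commutative square is a pushout square, i.e. the cocone with legs v and f' is a colimit of the span f, u). -/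
open CategoryTheory CategoryTheory.Limits

variable {𝒜 : Type*} [Category 𝒜] [Abelian 𝒜]

/-- In a semi-cartesian square with epimorphic bottom arrow, every pair of morphisms compatible
with the span factors through the bottom-right corner. -/
theorem IsSemiCartesian.exists_desc {A B A' B' T : 𝒜} {f : A ⟶ B} {u : A ⟶ A'} {v : B ⟶ B'}
    {f' : A' ⟶ B'} (hsc : IsSemiCartesian f u v f') [Epi f'] (g : B ⟶ T) (h : A' ⟶ T)
    (w : f ≫ g = u ≫ h) : ∃ d : B' ⟶ T, v ≫ d = g ∧ f' ≫ d = h := by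
  obtain ⟨z, hex⟩ := hsc
  have : Epi (ShortComplex.mk (biprod.lift f u) (biprod.desc v (-f')) z).g :=
    epi_of_epi_fac (f := biprod.inr) (h := -f') (by simp)
  have hk : biprod.lift f u ≫ biprod.desc g (-h) = 0 := by simp [w]
  have hd : biprod.desc v (-f') ≫ hex.desc (biprod.desc g (-h)) hk = biprod.desc g (-h) :=
    hex.g_desc _ hk
  refine ⟨hex.desc _ hk, ?_, ?_⟩
  · simpa using biprod.inl ≫= hd
  · simpa using biprod.inr ≫= hd

/-- Proposition 2 of §2 (second half): in a semi-cartesian square, if the bottom arrow `f'`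
is an epimorphism, then the top arrow `f` is an epimorphism and the square is
cocartesian. -/
theorem stmt7 {A B A' B' : 𝒜} (f : A ⟶ B) (u : A ⟶ A') (v : B ⟶ B') (f' : A' ⟶ B')
    (sq : f ≫ v = u ≫ f') (hsc : IsSemiCartesian f u v f') [Epi f'] :
    Epi f ∧ IsPushout f u v f' := by
  constructor
  · refine Preadditive.epi_of_cancel_zero f fun {T} g hg => ?_
    obtain ⟨d, rfl, hd⟩ := hsc.exists_desc g (0 : A' ⟶ T) (by simp [hg])
    rw [zero_of_epi_comp f' hd, comp_zero]
  · choose d hvd hfd using fun s : PushoutCocone f u =>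
      hsc.exists_desc s.inl s.inr s.condition
    exact ⟨⟨sq⟩, ⟨PushoutCocone.IsColimit.mk sq d hvd hfd fun s m _ hm => by
      rw [← cancel_epi f', hm, hfd]⟩⟩
end

section
/- In an abelian category, consider two horizontally composable commutative squares: top row f : A ⟶ B, g : B ⟶ C; bottom row f' : A' ⟶ B', g' : B' ⟶ C'; vertical arrows u : A ⟶ A', v : B ⟶ B', w : C ⟶ C' with v ∘ f = f' ∘ u and w ∘ g = g' ∘ v. Let K denote the left square (f, u, v, f'), L the right square (g, v, w, g'), and KL the composite square (g ∘ f, u, w, g' ∘ f'). If K is cocartesian (a pushout square), then KL is semi-cartesian if and only if L is semi-cartesian. -/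
open CategoryTheory CategoryTheory.Limits

variable {𝒜 : Type*} [Category 𝒜] [Abelian 𝒜]

/-- A commutative square is semi-cartesian iff every pair of generalized elements of `B` and `A'`
with the same image in `B'` lifts to `A` up to refinement. -/
theorem isSemiCartesian_iff_exists_lift_up_to_refinements {A B A' B' : 𝒜}
    {f : A ⟶ B} {u : A ⟶ A'} {v : B ⟶ B'} {f' : A' ⟶ B'} (sq : f ≫ v = u ≫ f') :
    IsSemiCartesian f u v f' ↔
      ∀ ⦃T : 𝒜⦄ (b : T ⟶ B) (a' : T ⟶ A') (_ : b ≫ v = a' ≫ f'),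
        ∃ (T' : 𝒜) (π : T' ⟶ T) (_ : Epi π) (a : T' ⟶ A),
          π ≫ b = a ≫ f ∧ π ≫ a' = a ≫ u := by
  have z : biprod.lift f u ≫ biprod.desc v (-f') = 0 := by simp [sq]
  rw [IsSemiCartesian, exists_prop_of_true z, ShortComplex.exact_iff_exact_up_to_refinements]
  constructor
  · intro h T b a' w
    obtain ⟨T', π, hπ, a, ha⟩ := h (biprod.lift b a') (by simp [w])
    exact ⟨T', π, hπ, a, by simpa using ha =≫ biprod.fst, by simpa using ha =≫ biprod.snd⟩
  · intro h T (x : T ⟶ B ⊞ A') (hx : x ≫ biprod.desc v (-f') = 0)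
    obtain ⟨T', π, hπ, a, h₁, h₂⟩ := h (x ≫ biprod.fst) (x ≫ biprod.snd) (by
      have hd : biprod.desc v (-f') = biprod.fst ≫ v - biprod.snd ≫ f' := by
        ext <;> simp
      rw [hd, Preadditive.comp_sub, sub_eq_zero] at hx
      simpa using hx)
    refine ⟨T', π, hπ, a, ?_⟩
    apply biprod.hom_ext
    · simpa using h₁
    · simpa using h₂

/-- In an abelian category, a pushout square is semi-cartesian. -/
theorem CategoryTheory.IsPushout.isSemiCartesian {A B A' B' : 𝒜}
    {f : A ⟶ B} {u : A ⟶ A'} {v : B ⟶ B'} {f' : A' ⟶ B'} (h : IsPushout f u v f') :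
    IsSemiCartesian f u v f' := by
  rw [isSemiCartesian_iff_exists_lift_up_to_refinements h.w]
  intro T b a' w
  have hx : biprod.lift b (-a') ≫ biprod.desc v f' = 0 := by simp [w]
  obtain ⟨T', π, hπ, (a : T' ⟶ A), (ha : π ≫ biprod.lift b (-a') = a ≫ biprod.lift f (-u))⟩ :=
    h.exact_shortComplex.exact_up_to_refinements _ hx
  exact ⟨T', π, hπ, a, by simpa using ha =≫ biprod.fst, by simpa using ha =≫ biprod.snd⟩

/-- Proposition 3(1) of §2: if the left square `K` is cocartesian, then the composite
square `KL` is semi-cartesian iff the right square `L` is semi-cartesian. -/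
theorem stmt8 {A B C A' B' C' : 𝒜}
    (f : A ⟶ B) (g : B ⟶ C) (f' : A' ⟶ B') (g' : B' ⟶ C')
    (u : A ⟶ A') (v : B ⟶ B') (w : C ⟶ C')
    (sq1 : f ≫ v = u ≫ f') (sq2 : g ≫ w = v ≫ g')
    (hK : IsPushout f u v f') :
    IsSemiCartesian (f ≫ g) u w (f' ≫ g') ↔ IsSemiCartesian g v w g' := by
  rw [isSemiCartesian_iff_exists_lift_up_to_refinements (by simp [sq2, reassoc_of% sq1]),
    isSemiCartesian_iff_exists_lift_up_to_refinements sq2]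
  constructor
  · intro h T c b' hc
    obtain ⟨T₁, π₁, _, b, a', hb'⟩ := hK.hom_eq_add_up_to_refinements b'
    obtain ⟨T₂, π₂, _, a, h₁, h₂⟩ := h (π₁ ≫ c - b ≫ g) a' (by
      simp [hc, reassoc_of% hb', sq2])
    refine ⟨T₂, π₂ ≫ π₁, inferInstance, π₂ ≫ b + a ≫ f, ?_, ?_⟩
    · rw [Preadditive.comp_sub, sub_eq_iff_eq_add'] at h₁
      simpa using h₁
    · simp [hb', sq1, reassoc_of% h₂]
  · intro h T c a' hc
    obtain ⟨T₁, π₁, _, b, h₁, h₂⟩ := h c (a' ≫ f') (by simpa using hc)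
    obtain ⟨T₂, π₂, _, a, h₃, h₄⟩ :=
      (isSemiCartesian_iff_exists_lift_up_to_refinements sq1).1 hK.isSemiCartesian
        b (π₁ ≫ a') (by simpa using h₂.symm)
    exact ⟨T₂, π₂ ≫ π₁, inferInstance, a, by simp [h₁, reassoc_of% h₃], by simpa using h₄⟩
end

section
/- In an abelian category, consider two horizontally composable commutative squares: top row f : A ⟶ B, g : B ⟶ C; bottom row f' : A' ⟶ B', g' : B' ⟶ C'; vertical arrows u : A ⟶ A', v : B ⟶ B', w : C ⟶ C' with v ∘ f = f' ∘ u and w ∘ g = g' ∘ v. If the left square (f, u, v, f') and the right square (g, v, w, g') are both semi-cartesian, then the composite square (g ∘ f, u, w, g' ∘ f') is semi-cartesian. -/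
open CategoryTheory CategoryTheory.Limits

variable {𝒜 : Type*} [Category 𝒜] [Abelian 𝒜]

/-- A commutative square is semi-cartesian iff, up to refinements, every pair of generalized
elements of `B` and `A'` with the same image in `B'` comes from a generalized element of `A`. -/
theorem isSemiCartesian_iff_up_to_refinements {A B A' B' : 𝒜} {f : A ⟶ B} {u : A ⟶ A'}
    {v : B ⟶ B'} {f' : A' ⟶ B'} (sq : f ≫ v = u ≫ f') :
    IsSemiCartesian f u v f' ↔
      ∀ ⦃T : 𝒜⦄ (b : T ⟶ B) (a' : T ⟶ A'), b ≫ v = a' ≫ f' →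
        ∃ (S : 𝒜) (π : S ⟶ T) (_ : Epi π) (a : S ⟶ A), π ≫ b = a ≫ f ∧ π ≫ a' = a ≫ u := by
  have z : biprod.lift f u ≫ biprod.desc v (-f') = 0 := by
    simp [biprod.lift_desc, sq]
  rw [IsSemiCartesian, exists_prop_of_true z, ShortComplex.exact_iff_exact_up_to_refinements]
  constructor
  · intro h T b a' hba
    obtain ⟨S, π, hπ, a, ha⟩ := h (biprod.lift b a') (by simp [biprod.lift_desc, hba])
    refine ⟨S, π, hπ, a, ?_, ?_⟩
    · simpa using ha =≫ biprod.fst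
    · simpa using ha =≫ biprod.snd
  · intro h T x hx
    have hx' : (x ≫ biprod.fst) ≫ v = (x ≫ biprod.snd) ≫ f' := by
      rw [← sub_eq_zero]
      simpa [biprod.desc_eq, sub_eq_add_neg] using hx
    obtain ⟨S, π, hπ, a, hb, ha'⟩ := h _ _ hx'
    refine ⟨S, π, hπ, a, ?_⟩
    apply biprod.hom_ext
    · simpa using hb
    · simpa using ha'

/-- Proposition 3(3) of §2: if both squares `K` and `L` are semi-cartesian, then the
composite square `KL` is semi-cartesian. -/
theorem stmt10 {A B C A' B' C' : 𝒜}
    (f : A ⟶ B) (g : B ⟶ C) (f' : A' ⟶ B') (g' : B' ⟶ C')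
    (u : A ⟶ A') (v : B ⟶ B') (w : C ⟶ C')
    (sq1 : f ≫ v = u ≫ f') (sq2 : g ≫ w = v ≫ g')
    (hK : IsSemiCartesian f u v f') (hL : IsSemiCartesian g v w g') :
    IsSemiCartesian (f ≫ g) u w (f' ≫ g') := by
  rw [isSemiCartesian_iff_up_to_refinements sq1] at hK
  rw [isSemiCartesian_iff_up_to_refinements sq2] at hL
  rw [isSemiCartesian_iff_up_to_refinements (by simp [sq2, reassoc_of% sq1])]
  intro T c a' h
  obtain ⟨S, π, _, b, hc, hb⟩ := hL c (a' ≫ f') (by simpa using h)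
  obtain ⟨R, ρ, _, a, ha, ha'⟩ := hK b (π ≫ a') (by simpa using hb.symm)
  exact ⟨R, ρ ≫ π, inferInstance, a, by simp [hc, reassoc_of% ha], by simpa using ha'⟩
end

section
/- In an abelian category, consider two horizontally composable commutative squares: top row f : A ⟶ B, g : B ⟶ C; bottom row f' : A' ⟶ B', g' : B' ⟶ C'; vertical arrows u : A ⟶ A', v : B ⟶ B', w : C ⟶ C' with v ∘ f = f' ∘ u and w ∘ g = g' ∘ v. Suppose the composite square (g ∘ f, u, w, g' ∘ f') is semi-cartesian. If both horizontal arrows of the left square are epimorphisms (f and f' epi), then the right square (g, v, w, g') is semi-cartesian. -/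
open CategoryTheory CategoryTheory.Limits

variable {𝒜 : Type*} [Category 𝒜] [Abelian 𝒜]

/-- Proposition 4 of §2 (first half): if the composite square `KL` is semi-cartesian and
both horizontal arrows of the left square are epimorphisms, then the right square `L`
is semi-cartesian. -/
theorem stmt11 {A B C A' B' C' : 𝒜}
    (f : A ⟶ B) (g : B ⟶ C) (f' : A' ⟶ B') (g' : B' ⟶ C')
    (u : A ⟶ A') (v : B ⟶ B') (w : C ⟶ C')
    (sq1 : f ≫ v = u ≫ f') (sq2 : g ≫ w = v ≫ g')
    (hKL : IsSemiCartesian (f ≫ g) u w (f' ≫ g')) [Epi f] [Epi f'] :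
    IsSemiCartesian g v w g' := by
  obtain ⟨_, hex⟩ := hKL
  rw [ShortComplex.exact_iff_exact_up_to_refinements] at hex
  refine ⟨by simp [sq2], ?_⟩
  rw [ShortComplex.exact_iff_exact_up_to_refinements]
  intro T x hx
  dsimp at x hx
  obtain ⟨T₁, π₁, hπ₁, a', ha'⟩ :=
    surjective_up_to_refinements_of_epi f' (x ≫ biprod.snd)
  have hx' : x ≫ biprod.fst ≫ w = x ≫ biprod.snd ≫ g' := by
    have hdesc : biprod.desc w (-g') = biprod.fst ≫ w - biprod.snd ≫ g' := by
      ext <;> simp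
    simpa [sub_eq_zero] using (congrArg (x ≫ ·) hdesc).symm.trans hx
  obtain ⟨T₂, π₂, hπ₂, a, ha⟩ := hex (biprod.lift (π₁ ≫ x ≫ biprod.fst) a') (by
    simp only [biprod.lift_desc, Category.assoc, hx', Preadditive.comp_neg]
    rw [← reassoc_of% ha']
    simp)
  dsimp at a ha
  have hfst : π₂ ≫ π₁ ≫ x ≫ biprod.fst = a ≫ f ≫ g := by
    simpa using ha =≫ biprod.fst
  have hsnd : π₂ ≫ a' = a ≫ u := by
    simpa using ha =≫ biprod.snd
  refine ⟨T₂, π₂ ≫ π₁, inferInstance, a ≫ f, ?_⟩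
  dsimp
  ext
  · simpa using hfst
  · simp [ha', sq1, reassoc_of% hsnd]
end

section
/- In an abelian category, consider two horizontally composable commutative squares: top row f : A ⟶ B, g : B ⟶ C; bottom row f' : A' ⟶ B', g' : B' ⟶ C'; vertical arrows u : A ⟶ A', v : B ⟶ B', w : C ⟶ C' with v ∘ f = f' ∘ u and w ∘ g = g' ∘ v. Suppose the composite square (g ∘ f, u, w, g' ∘ f') is semi-cartesian. If both horizontal arrows of the right square are monomorphisms (g and g' mono), then the left square (f, u, v, f') is semi-cartesian. -/
open CategoryTheory CategoryTheory.Limits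

variable {𝒜 : Type*} [Category 𝒜] [Abelian 𝒜]

/-- Proposition 4 of §2 (second half): if the composite square `KL` is semi-cartesian and
both horizontal arrows of the right square are monomorphisms, then the left square `K`
is semi-cartesian. -/
theorem stmt12 {A B C A' B' C' : 𝒜}
    (f : A ⟶ B) (g : B ⟶ C) (f' : A' ⟶ B') (g' : B' ⟶ C')
    (u : A ⟶ A') (v : B ⟶ B') (w : C ⟶ C')
    (sq1 : f ≫ v = u ≫ f') (sq2 : g ≫ w = v ≫ g')
    (hKL : IsSemiCartesian (f ≫ g) u w (f' ≫ g')) [Mono g] [Mono g'] :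
    IsSemiCartesian f u v f' := by
  obtain ⟨_, hex⟩ := hKL
  refine ⟨by simp [sq1], ?_⟩
  rw [ShortComplex.exact_iff_exact_up_to_refinements]
  intro T x hx
  dsimp at x hx
  have hx' : x ≫ biprod.fst ≫ v = x ≫ biprod.snd ≫ f' := by
    simpa [biprod.desc_eq, ← sub_eq_add_neg, sub_eq_zero] using hx
  obtain ⟨T', p, hp, y, hy⟩ := hex.exact_up_to_refinements
    (biprod.lift (x ≫ biprod.fst ≫ g) (x ≫ biprod.snd)) (by
      simp [sq2, reassoc_of% hx'])
  dsimp at y hy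
  have hfst := hy =≫ biprod.fst
  have hsnd := hy =≫ biprod.snd
  simp only [Category.assoc, biprod.lift_fst, biprod.lift_snd] at hfst hsnd
  refine ⟨T', p, hp, y, ?_⟩
  dsimp
  ext
  · simpa [← cancel_mono g] using hfst
  · simpa using hsnd
end

section
/- Let a semi-cartesian square in an abelian category be given by top arrow f : A ⟶ B, left arrow u : A ⟶ A', right arrow v : B ⟶ B', bottom arrow f' : A' ⟶ B' with v ∘ f = f' ∘ u. Then there exist objects M, M', a morphism μ : M ⟶ M', epimorphisms e : A ⟶ M and e' : A' ⟶ M', and monomorphisms i : M ⟶ B and i' : M' ⟶ B', such that f = i ∘ e, f' = i' ∘ e', μ ∘ e = e' ∘ u, v ∘ i = i' ∘ μ, the square (e, u, μ, e') is cocartesian (a pushout square), and the square (i, μ, v, i') is cartesian (a pullback square). -/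
open CategoryTheory CategoryTheory.Limits

variable {𝒜 : Type*} [Category 𝒜] [Abelian 𝒜]

/-- In a semi-cartesian square, generalized elements `b` of `B` and `a'` of `A'` with the same
image in `B'` come, after refinement, from a generalized element of `A`. -/
lemma IsSemiCartesian.exists_lift_up_to_refinements {A B A' B' : 𝒜} {f : A ⟶ B} {u : A ⟶ A'}
    {v : B ⟶ B'} {f' : A' ⟶ B'} (h : IsSemiCartesian f u v f') {T : 𝒜} (b : T ⟶ B)
    (a' : T ⟶ A') (w : b ≫ v = a' ≫ f') :
    ∃ (T' : 𝒜) (π : T' ⟶ T) (_ : Epi π) (a : T' ⟶ A), π ≫ b = a ≫ f ∧ π ≫ a' = a ≫ u := by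
  obtain ⟨z, hz⟩ := h
  obtain ⟨T', π, hπ, a, ha⟩ := hz.exact_up_to_refinements (biprod.lift b a') (by simp [w])
  refine ⟨T', π, hπ, a, ?_, ?_⟩
  · simpa using ha =≫ biprod.fst
  · simpa using ha =≫ biprod.snd

/-- If the rows of a semi-cartesian square factor as `e ≫ i` and `e' ≫ i'` with `e`, `e'`
epimorphisms and `i` a monomorphism, the left-hand square is cocartesian. -/
lemma IsSemiCartesian.isPushout {A B A' B' M M' : 𝒜} {f : A ⟶ B} {u : A ⟶ A'}
    {v : B ⟶ B'} {f' : A' ⟶ B'} (h : IsSemiCartesian f u v f') {μ : M ⟶ M'} {e : A ⟶ M}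
    {e' : A' ⟶ M'} {i : M ⟶ B} {i' : M' ⟶ B'} [Epi e] [Epi e'] [Mono i]
    (hf : e ≫ i = f) (hf' : e' ≫ i' = f') (w : e ≫ μ = u ≫ e') : IsPushout e u μ e' := by
  have key {T : 𝒜} (s : M ⟶ T) (t : A' ⟶ T) (hst : e ≫ s = u ≫ t) : kernel.ι e' ≫ t = 0 := by
    obtain ⟨T', π, _, a, ha, ha'⟩ := h.exists_lift_up_to_refinements 0 (kernel.ι e')
      (by simp [← hf'])
    have hae : a ≫ e = 0 := by
      rw [← cancel_mono i, Category.assoc, hf, ← ha, comp_zero, zero_comp]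
    rw [← cancel_epi π, reassoc_of% ha', ← hst, reassoc_of% hae, zero_comp, comp_zero]
  refine ⟨⟨w⟩, ⟨PushoutCocone.IsColimit.mk w
    (fun s ↦ Abelian.epiDesc e' s.inr (key _ _ s.condition)) (fun s ↦ ?_)
    (fun s ↦ Abelian.comp_epiDesc _ _ _) (fun s m _ hm ↦ ?_)⟩⟩
  · rw [← cancel_epi e, reassoc_of% w, Abelian.comp_epiDesc, s.condition]
  · rw [← cancel_epi e', hm, Abelian.comp_epiDesc]

/-- If the rows of a semi-cartesian square factor as `e ≫ i` and `e' ≫ i'` with `e'` an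
epimorphism and `i`, `i'` monomorphisms, the right-hand square is cartesian. -/
lemma IsSemiCartesian.isPullback {A B A' B' M M' : 𝒜} {f : A ⟶ B} {u : A ⟶ A'}
    {v : B ⟶ B'} {f' : A' ⟶ B'} (h : IsSemiCartesian f u v f') {μ : M ⟶ M'} {e : A ⟶ M}
    {e' : A' ⟶ M'} {i : M ⟶ B} {i' : M' ⟶ B'} [Epi e'] [Mono i] [Mono i']
    (hf : e ≫ i = f) (hf' : e' ≫ i' = f') (w : i ≫ v = μ ≫ i') : IsPullback i μ v i' := by
  have key {T : 𝒜} (x : T ⟶ B) (y : T ⟶ M') (hxy : x ≫ v = y ≫ i') :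
      x ≫ cokernel.π i = 0 := by
    obtain ⟨T₁, π₁, _, a', ha'⟩ := surjective_up_to_refinements_of_epi e' y
    obtain ⟨T₂, π₂, _, a, ha, -⟩ := h.exists_lift_up_to_refinements (π₁ ≫ x) a'
      (by rw [Category.assoc, hxy, reassoc_of% ha', hf'])
    rw [← cancel_epi π₁, ← cancel_epi π₂, reassoc_of% ha, ← hf]
    simp
  refine ⟨⟨w⟩, ⟨PullbackCone.IsLimit.mk w
    (fun s ↦ Abelian.monoLift i s.fst (key _ _ s.condition))
    (fun s ↦ Abelian.monoLift_comp _ _ _) (fun s ↦ ?_) (fun s m hm _ ↦ ?_)⟩⟩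
  · rw [← cancel_mono i', Category.assoc, ← w, ← Category.assoc, Abelian.monoLift_comp,
      s.condition]
  · rw [← cancel_mono i, hm, Abelian.monoLift_comp]

/-- Corollary of Proposition 4 of §2: every semi-cartesian square decomposes into a
cocartesian square with epimorphism horizontal arrows followed by a cartesian square
with monomorphism horizontal arrows. -/
theorem stmt13 {A B A' B' : 𝒜} (f : A ⟶ B) (u : A ⟶ A') (v : B ⟶ B') (f' : A' ⟶ B')
    (sq : f ≫ v = u ≫ f') (hsc : IsSemiCartesian f u v f') :
    ∃ (M M' : 𝒜) (μ : M ⟶ M') (e : A ⟶ M) (e' : A' ⟶ M') (i : M ⟶ B) (i' : M' ⟶ B'),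
      Epi e ∧ Epi e' ∧ Mono i ∧ Mono i' ∧
      f = e ≫ i ∧ f' = e' ≫ i' ∧
      e ≫ μ = u ≫ e' ∧ i ≫ v = μ ≫ i' ∧
      IsPushout e u μ e' ∧ IsPullback i μ v i' := by
  let φ : Arrow.mk f ⟶ Arrow.mk f' := Arrow.homMk u v sq.symm
  have w : factorThruImage f ≫ image.map φ = u ≫ factorThruImage f' := image.factor_map φ
  have w' : image.ι f ≫ v = image.map φ ≫ image.ι f' := (image.map_ι φ).symm
  exact ⟨image f, image f', image.map φ, factorThruImage f, factorThruImage f', image.ι f,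
    image.ι f', inferInstance, inferInstance, inferInstance, inferInstance,
    (image.fac f).symm, (image.fac f').symm, w, w',
    hsc.isPushout (image.fac f) (image.fac f') w, hsc.isPullback (image.fac f) (image.fac f') w'⟩
end

section
/- In an abelian category, consider two horizontally composable commutative squares: top row f : A ⟶ B, g : B ⟶ C; bottom row f' : A' ⟶ B', g' : B' ⟶ C'; vertical arrows u : A ⟶ A', v : B ⟶ B', w : C ⟶ C' with v ∘ f = f' ∘ u and w ∘ g = g' ∘ v. Suppose the left square is a kernel of the right square componentwise: f is a kernel of g and f' is a kernel of g'. If w is a monomorphism, then the left square (f, u, v, f') is cartesian (a pullback square). -/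
open CategoryTheory CategoryTheory.Limits

/-- Proposition 5(1)(a) of §2: if the left square is a componentwise kernel of the right
square (`f` is a kernel of `g` and `f'` is a kernel of `g'`) and `w` is a monomorphism,
then the left square is cartesian. -/
theorem stmt14 {𝒜 : Type*} [Category 𝒜] [Abelian 𝒜] {A B C A' B' C' : 𝒜}
    (f : A ⟶ B) (g : B ⟶ C) (f' : A' ⟶ B') (g' : B' ⟶ C')
    (u : A ⟶ A') (v : B ⟶ B') (w : C ⟶ C')
    (sq1 : f ≫ v = u ≫ f') (sq2 : g ≫ w = v ≫ g')
    (hg : f ≫ g = 0) (hker : Nonempty (IsLimit (KernelFork.ofι f hg)))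
    (hg' : f' ≫ g' = 0) (hker' : Nonempty (IsLimit (KernelFork.ofι f' hg')))
    [Mono w] :
    IsPullback f u v f' := by
  obtain ⟨hk⟩ := hker
  obtain ⟨hk'⟩ := hker'
  have : Mono f := mono_of_isLimit_fork hk
  have : Mono f' := mono_of_isLimit_fork hk'
  refine ⟨⟨sq1⟩, ⟨PullbackCone.IsLimit.mk sq1
    (fun s => hk.lift (KernelFork.ofι s.fst ?_)) (fun s => ?_) (fun s => ?_)
    (fun s m hm _ => ?_)⟩⟩
  · rw [← cancel_mono w, Category.assoc, sq2, s.condition_assoc, hg', comp_zero, zero_comp]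
  · exact Fork.IsLimit.lift_ι hk
  · rw [← cancel_mono f', Category.assoc, ← sq1, ← s.condition]
    exact (Category.assoc _ _ _).symm.trans (congrArg (· ≫ v) (Fork.IsLimit.lift_ι hk))
  · rw [← cancel_mono f]
    exact hm.trans (Fork.IsLimit.lift_ι (t := KernelFork.ofι s.fst _) hk).symm
end

section
/- In an abelian category, consider two horizontally composable commutative squares: top row f : A ⟶ B, g : B ⟶ C; bottom row f' : A' ⟶ B', g' : B' ⟶ C'; vertical arrows u : A ⟶ A', v : B ⟶ B', w : C ⟶ C' with v ∘ f = f' ∘ u and w ∘ g = g' ∘ v. Suppose the left square is a kernel of the right square componentwise: f is a kernel of g and f' is a kernel of g'. If the right square (g, v, w, g') is semi-cartesian, then u is an epimorphism. -/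
open CategoryTheory CategoryTheory.Limits

variable {𝒜 : Type*} [Category 𝒜] [Abelian 𝒜]

/-- Proposition 5(1)(b) of §2: if the left square is a componentwise kernel of the right
square (`f` is a kernel of `g` and `f'` is a kernel of `g'`) and the right square is
semi-cartesian, then `u` is an epimorphism. -/
theorem stmt15 {A B C A' B' C' : 𝒜}
    (f : A ⟶ B) (g : B ⟶ C) (f' : A' ⟶ B') (g' : B' ⟶ C')
    (u : A ⟶ A') (v : B ⟶ B') (w : C ⟶ C')
    (sq1 : f ≫ v = u ≫ f') (sq2 : g ≫ w = v ≫ g')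
    (hg : f ≫ g = 0) (hker : Nonempty (IsLimit (KernelFork.ofι f hg)))
    (hg' : f' ≫ g' = 0) (hker' : Nonempty (IsLimit (KernelFork.ofι f' hg')))
    (hL : IsSemiCartesian g v w g') :
    Epi u := by
  obtain ⟨z, hex⟩ := hL
  obtain ⟨hker⟩ := hker
  obtain ⟨hker'⟩ := hker'
  have : Mono f' := mono_of_isLimit_fork hker'
  rw [epi_iff_surjective_up_to_refinements]
  intro T y
  obtain ⟨T', π, hπ, b, hb⟩ := hex.exact_up_to_refinements
    (biprod.lift (0 : T ⟶ C) (y ≫ f')) (by simp [hg'])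
  have hb_fst : b ≫ g = 0 := by
    simpa using (congrArg (· ≫ biprod.fst) hb).symm
  have hb_snd : π ≫ y ≫ f' = b ≫ v := by
    simpa using congrArg (· ≫ biprod.snd) hb
  obtain ⟨a, ha⟩ := KernelFork.IsLimit.lift' hker b hb_fst
  replace ha : a ≫ f = b := ha
  refine ⟨T', π, hπ, a, ?_⟩
  rw [← cancel_mono f', Category.assoc, Category.assoc, hb_snd, ← ha, Category.assoc, sq1]
end

section
/- In an abelian category, consider two horizontally composable commutative squares: top row f : A ⟶ B, g : B ⟶ C; bottom row f' : A' ⟶ B', g' : B' ⟶ C'; vertical arrows u : A ⟶ A', v : B ⟶ B', w : C ⟶ C' with v ∘ f = f' ∘ u and w ∘ g = g' ∘ v. Suppose the right square is a cokernel of the left square componentwise: g is a cokernel of f and g' is a cokernel of f'. If u is an epimorphism, then the right square (g, v, w, g') is cocartesian (a pushout square). -/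
open CategoryTheory CategoryTheory.Limits

/-- Proposition 5(2)(c) of §2: if the right square is a componentwise cokernel of the left
square (`g` is a cokernel of `f` and `g'` is a cokernel of `f'`) and `u` is an epimorphism,
then the right square is cocartesian. -/
theorem stmt16 {𝒜 : Type*} [Category 𝒜] [Abelian 𝒜] {A B C A' B' C' : 𝒜}
    (f : A ⟶ B) (g : B ⟶ C) (f' : A' ⟶ B') (g' : B' ⟶ C')
    (u : A ⟶ A') (v : B ⟶ B') (w : C ⟶ C')
    (sq1 : f ≫ v = u ≫ f') (sq2 : g ≫ w = v ≫ g')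
    (hf : f ≫ g = 0) (hcoker : Nonempty (IsColimit (CokernelCofork.ofπ g hf)))
    (hf' : f' ≫ g' = 0) (hcoker' : Nonempty (IsColimit (CokernelCofork.ofπ g' hf')))
    [Epi u] :
    IsPushout g v w g' := by
  obtain ⟨hg⟩ := hcoker
  obtain ⟨hg'⟩ := hcoker'
  have : Epi g := Cofork.IsColimit.epi hg
  have : Epi g' := Cofork.IsColimit.epi hg'
  refine IsPushout.of_isColimit' ⟨sq2⟩ (PushoutCocone.IsColimit.mk _
    (fun s => hg'.desc (CokernelCofork.ofπ s.inr ?_)) (fun s => ?_) (fun s => ?_)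
    fun s m _ hm => ?_)
  · rw [← cancel_epi u, ← reassoc_of% sq1, ← s.condition, reassoc_of% hf, zero_comp, comp_zero]
  · rw [← cancel_epi g, reassoc_of% sq2]
    exact (congrArg (v ≫ ·) (hg'.fac _ WalkingParallelPair.one)).trans s.condition.symm
  · exact hg'.fac _ WalkingParallelPair.one
  · rw [← cancel_epi g']
    refine hm.trans (Eq.symm ?_)
    exact hg'.fac _ WalkingParallelPair.one
end

section
/- In an abelian category, consider two horizontally composable commutative squares: top row f : A ⟶ B, g : B ⟶ C; bottom row f' : A' ⟶ B', g' : B' ⟶ C'; vertical arrows u : A ⟶ A', v : B ⟶ B', w : C ⟶ C' with v ∘ f = f' ∘ u and w ∘ g = g' ∘ v. Suppose the right square is a cokernel of the left square componentwise: g is a cokernel of f and g' is a cokernel of f'. If the left square (f, u, v, f') is semi-cartesian, then w is a monomorphism. -/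
open CategoryTheory CategoryTheory.Limits

variable {𝒜 : Type*} [Category 𝒜] [Abelian 𝒜]

/-- Proposition 5(2)(d) of §2: if the right square is a componentwise cokernel of the left
square (`g` is a cokernel of `f` and `g'` is a cokernel of `f'`) and the left square is
semi-cartesian, then `w` is a monomorphism. -/
theorem stmt17 {A B C A' B' C' : 𝒜}
    (f : A ⟶ B) (g : B ⟶ C) (f' : A' ⟶ B') (g' : B' ⟶ C')
    (u : A ⟶ A') (v : B ⟶ B') (w : C ⟶ C')
    (sq1 : f ≫ v = u ≫ f') (sq2 : g ≫ w = v ≫ g')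
    (hf : f ≫ g = 0) (hcoker : Nonempty (IsColimit (CokernelCofork.ofπ g hf)))
    (hf' : f' ≫ g' = 0) (hcoker' : Nonempty (IsColimit (CokernelCofork.ofπ g' hf')))
    (hK : IsSemiCartesian f u v f') :
    Mono w := by
  have : Epi g := epi_of_isColimit_cofork hcoker.some
  obtain ⟨z, hex⟩ := hK
  have hex' : (ShortComplex.mk f' g' hf').Exact :=
    ShortComplex.exact_of_g_is_cokernel _ hcoker'.some
  refine Preadditive.mono_of_cancel_zero _ fun {P} x hx => ?_
  obtain ⟨P₁, p₁, _, b, hb⟩ := surjective_up_to_refinements_of_epi g x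
  obtain ⟨P₂, p₂, _, a', ha'⟩ := hex'.exact_up_to_refinements (b ≫ v) (by
    simp [← sq2, ← reassoc_of% hb, hx])
  obtain ⟨P₃, p₃, _, a, ha⟩ := hex.exact_up_to_refinements (biprod.lift (p₂ ≫ b) a') (by
    simpa [biprod.lift_desc, sub_eq_add_neg] using sub_eq_zero.mpr ha')
  have hab : p₃ ≫ p₂ ≫ b = a ≫ f := by
    simpa using ha =≫ biprod.fst
  rw [← cancel_epi p₁, ← cancel_epi p₂, ← cancel_epi p₃, hb, reassoc_of% hab, hf]
  simp
end

section
/- In an abelian category, consider two horizontally composable commutative squares: top row f : A ⟶ B, g : B ⟶ C; bottom row f' : A' ⟶ B', g' : B' ⟶ C'; vertical arrows u : A ⟶ A', v : B ⟶ B', w : C ⟶ C' with v ∘ f = f' ∘ u and w ∘ g = g' ∘ v. (1) If the right square (g, v, w, g') is semi-cartesian, the top row (f, g) is exact at B, and g' ∘ f' = 0, then the bottom row (f', g') is exact at B'. (2) Dually, if the left square (f, u, v, f') is semi-cartesian, the bottom row (f', g') is exact at B', and g ∘ f = 0, then the top row (f, g) is exact at B. -/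
open CategoryTheory CategoryTheory.Limits

variable {𝒜 : Type*} [Category 𝒜] [Abelian 𝒜]

/-- Proposition 1 of §3.
(1) If the right square is semi-cartesian, the top row `(f, g)` is exact and
`f' ≫ g' = 0`, then the bottom row `(f', g')` is exact.
(2) Dually, if the left square is semi-cartesian, the bottom row `(f', g')` is exact and
`f ≫ g = 0`, then the top row `(f, g)` is exact. -/
theorem stmt18 {A B C A' B' C' : 𝒜}
    (f : A ⟶ B) (g : B ⟶ C) (f' : A' ⟶ B') (g' : B' ⟶ C')
    (u : A ⟶ A') (v : B ⟶ B') (w : C ⟶ C')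
    (sq1 : f ≫ v = u ≫ f') (sq2 : g ≫ w = v ≫ g') :
    (∀ (hfg : f ≫ g = 0) (hfg' : f' ≫ g' = 0),
      IsSemiCartesian g v w g' → (ShortComplex.mk f g hfg).Exact →
      (ShortComplex.mk f' g' hfg').Exact) ∧
    (∀ (hfg : f ≫ g = 0) (hfg' : f' ≫ g' = 0),
      IsSemiCartesian f u v f' → (ShortComplex.mk f' g' hfg').Exact →
      (ShortComplex.mk f g hfg).Exact) := by
  constructor
  · rintro hfg hfg' ⟨z, hz⟩ h
    rw [ShortComplex.exact_iff_exact_up_to_refinements]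
    intro T y hy
    dsimp at y hy
    obtain ⟨T₁, p, _, b, hb⟩ := hz.exact_up_to_refinements (biprod.lift 0 y) (by simp [hy])
    dsimp at b hb
    have hbg : b ≫ g = 0 := by simpa using (hb =≫ biprod.fst).symm
    have hbv : p ≫ y = b ≫ v := by simpa using hb =≫ biprod.snd
    obtain ⟨T₂, q, _, a, ha⟩ := h.exact_up_to_refinements b hbg
    dsimp at a ha
    exact ⟨T₂, q ≫ p, inferInstance, a ≫ u, by simp [hbv, reassoc_of% ha, sq1]⟩
  · rintro hfg hfg' ⟨z, hz⟩ h
    rw [ShortComplex.exact_iff_exact_up_to_refinements]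
    intro T b hb
    dsimp at b hb
    obtain ⟨T₁, p, _, a', ha'⟩ :=
      h.exact_up_to_refinements (b ≫ v) (by simp [← sq2, reassoc_of% hb])
    dsimp at a' ha'
    obtain ⟨T₂, q, _, a, ha⟩ :=
      hz.exact_up_to_refinements (biprod.lift (p ≫ b) a') (by simp [ha'])
    dsimp at a ha
    exact ⟨T₂, q ≫ p, inferInstance, a, by simpa using ha =≫ biprod.fst⟩
end
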